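/- Preservation of existentially closed facts by loop bodies (soundness of invariant strengthening): let s be a loop body, M = modVars(s) its set of potentially modified variables, and p any predicate. If σ ⊨ ∃M. p (the existential closure of p over the variables in M) and ⟨σ, s⟩ ⇓ σ', then σ' ⊨ ∃M. p. Consequently, if inv is an invariant of the loop while g do s od established on entry from a state satisfying p, then inv ∧ ∃M. p is also an invariant of that loop: it holds on entry and is re-established by every execution of the body from a state where it holds together with the guard. -/

import Mathlib

namespace Pest

/-- Program variables. -/
abbrev Var := String

/-- Values. -/
abbrev Val := Int

/-- States map variables to values. -/
abbrev State := Var → Val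

/-- State update `σ[v ↦ n]`. -/
def State.upd (σ : State) (v : Var) (n : Val) : State :=
  fun w => if w = v then n else σ w

/-- Expressions: a partial evaluation `⟦e⟧σ` together with a safety predicate
    `safe(e)` such that `σ ⊨ safe(e)` implies `⟦e⟧σ` is defined. -/
structure Expr (α : Type) where
  eval : State → Option α
  safe : State → Prop
  safe_eval : ∀ σ : State, safe σ → (eval σ).isSome

abbrev IExpr := Expr Val
abbrev BExpr := Expr Bool

/-- Predicates on states; `σ ⊨ p` is `p σ`. -/
abbrev Pred := State → Prop

/-- Semantic entailment `p ⊨ q`. -/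
def Entails (p q : Pred) : Prop := ∀ σ : State, p σ → q σ

/-- Pest statements, including local variable declarations `local v ← e`.
    A while-loop `while g :?! inv :# var do s od` carries an invariant
    annotation `inv` and an integer variant annotation `var`. -/
inductive Stmt where
  | skip : Stmt
  | assign : Var → IExpr → Stmt
  | locl : Var → IExpr → Stmt
  | seq : Stmt → Stmt → Stmt
  | ite : BExpr → Stmt → Stmt → Stmt
  | whileLoop : BExpr → BExpr → IExpr → Stmt → Stmt   -- guard, invariant, variant, body

/-- Big-step operational semantics `⟨σ, s⟩ ⇓ σ'`, in which annotations act as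
    assertions. -/
inductive BigStep : State → Stmt → State → Prop where
  | skip (σ : State) : BigStep σ .skip σ
  | assign {σ : State} {v : Var} {e : IExpr} {n : Val} :
      e.eval σ = some n → BigStep σ (.assign v e) (σ.upd v n)
  | locl {σ : State} {v : Var} {e : IExpr} {n : Val} :
      e.eval σ = some n → BigStep σ (.locl v e) (σ.upd v n)
  | seq {σ σ' σ'' : State} {s₁ s₂ : Stmt} :
      BigStep σ s₁ σ' → BigStep σ' s₂ σ'' → BigStep σ (.seq s₁ s₂) σ''
  | iteTrue {σ σ' : State} {g : BExpr} {s₁ s₂ : Stmt} :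
      g.eval σ = some true → BigStep σ s₁ σ' → BigStep σ (.ite g s₁ s₂) σ'
  | iteFalse {σ σ' : State} {g : BExpr} {s₁ s₂ : Stmt} :
      g.eval σ = some false → BigStep σ s₂ σ' → BigStep σ (.ite g s₁ s₂) σ'
  | whileFalse {σ : State} {g inv : BExpr} {vr : IExpr} {s : Stmt} :
      inv.eval σ = some true → g.eval σ = some false →
      BigStep σ (.whileLoop g inv vr s) σ
  | whileTrue {σ σ' σ'' : State} {g inv : BExpr} {vr : IExpr} {s : Stmt} {n n' : Val} :
      inv.eval σ = some true → g.eval σ = some true →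
      vr.eval σ = some n → 0 < n →
      BigStep σ s σ' →
      vr.eval σ' = some n' → n' < n →
      BigStep σ' (.whileLoop g inv vr s) σ'' →
      BigStep σ (.whileLoop g inv vr s) σ''


/-- `modVars s`: the syntactic over-approximation of the set of variables
    potentially modified by `s`. -/
def modVars : Stmt → Finset Var
  | .skip => ∅
  | .assign v _ => {v}
  | .locl v _ => {v}
  | .seq s₁ s₂ => modVars s₁ ∪ modVars s₂
  | .ite _ s₁ s₂ => modVars s₁ ∪ modVars s₂
  | .whileLoop _ _ _ s => modVars s


/-- Existential closure `∃ M. p` of a predicate over a finite set of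
    variables: `σ` satisfies it iff some reassignment of the variables in `M`
    yields a state satisfying `p`. -/
def ExClose (M : Finset Var) (p : Pred) : Pred :=
  fun σ => ∃ ρ : Var → Val, p (fun w => if w ∈ M then ρ w else σ w)

/-- Executing `s` leaves every variable outside `modVars s` unchanged. -/
theorem BigStep.eq_of_notMem_modVars {σ σ' : State} {s : Stmt} (h : BigStep σ s σ')
    {v : Var} (hv : v ∉ modVars s) : σ' v = σ v := by
  induction h <;> simp_all [modVars, State.upd]

/-- `∃ M. p` only depends on the values of the variables outside `M`. -/
theorem ExClose.of_eqOn_compl {M : Finset Var} {p : Pred} {σ σ' : State}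
    (h : ExClose M p σ) (heq : ∀ v ∉ M, σ' v = σ v) : ExClose M p σ' := by
  obtain ⟨ρ, hρ⟩ := h
  refine ⟨ρ, ?_⟩
  convert hρ using 2 with w
  split_ifs with hw
  · rfl
  · exact heq w hw

/-- A predicate entails its existential closure. -/
theorem entails_exClose (M : Finset Var) (p : Pred) : Entails p (ExClose M p) :=
  fun σ hσ => ⟨σ, by simpa using hσ⟩

/-- The existential closure over `modVars s` is preserved by executing `s`. -/
theorem ExClose.bigStep {s : Stmt} {p : Pred} {σ σ' : State}
    (h : ExClose (modVars s) p σ) (hs : BigStep σ s σ') : ExClose (modVars s) p σ' :=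
  h.of_eqOn_compl fun _ hv => hs.eq_of_notMem_modVars hv

/-- Preservation of existentially closed facts by loop bodies (soundness of
    invariant strengthening).  Let `s` be a loop body, `M = modVars s`, and
    `p` any predicate.  Then (i) if `σ ⊨ ∃M. p` and `⟨σ, s⟩ ⇓ σ'` then
    `σ' ⊨ ∃M. p`; consequently (ii) if `inv` is an invariant of the loop
    `while g do s od`, then `inv ∧ ∃M. p` is also an invariant of that loop:
    it holds on entry from any state satisfying `p` (on which `inv` was
    established), and it is re-established by every execution of the body from
    a state where it holds together with the guard `g`. -/
theorem exclose_invariant_strengthening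
    (s : Stmt) (p : Pred) :
    -- (i) existentially closed facts are preserved by the loop body
    (∀ σ σ' : State, ExClose (modVars s) p σ → BigStep σ s σ' →
        ExClose (modVars s) p σ') ∧
    -- (ii) consequently, invariant strengthening is sound
    (∀ inv g : Pred,
      (∀ σ σ' : State, inv σ → g σ → BigStep σ s σ' → inv σ') →
      -- inv ∧ ∃M. p holds on entry
      (∀ σ : State, p σ → inv σ → inv σ ∧ ExClose (modVars s) p σ) ∧
      -- inv ∧ ∃M. p is re-established by every execution of the body
      (∀ σ σ' : State, inv σ ∧ ExClose (modVars s) p σ → g σ →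
          BigStep σ s σ' → inv σ' ∧ ExClose (modVars s) p σ')) := by
  exact ⟨fun _ _ h hs => h.bigStep hs, fun _ _ hinv =>
    ⟨fun σ hp hi => ⟨hi, entails_exClose _ p σ hp⟩,
      fun σ σ' h hg hs => ⟨hinv σ σ' h.1 hg hs, h.2.bigStep hs⟩⟩⟩

end Pest
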